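/- Let K be a field of characteristic two and let G be the quaternion group of order 8. Then Ext^1_{KG}(M,M) ≠ 0 for every non-projective finite-dimensional KG-module M. -/

import Mathlib

open CategoryTheory

universe u

section HomologicalDefs

variable (R : Type u) [Ring R]

/-- The `i`-th Ext group of the `R`-modules `M` and `N`, computed in `ModuleCat R`. -/
noncomputable def extGrp (i : ℕ) (M N : ModuleCat.{u} R) : Type u :=
  ((Ext ℤ (ModuleCat.{u} R) i).obj (Opposite.op M)).obj N

/-- `Ext^i_R(M, N) = 0`. -/
def ExtVanish (i : ℕ) (M N : ModuleCat.{u} R) : Prop :=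
  Subsingleton (extGrp R i M N)

/-- `X` lies in `add M`: it is a direct summand of a finite direct sum of copies of `M`. -/
def MemAdd (M X : ModuleCat.{u} R) : Prop :=
  ∃ (k : ℕ) (f : X →ₗ[R] (Fin k → M)) (g : (Fin k → M) →ₗ[R] X),
    g.comp f = LinearMap.id

/-- `M` is an `n`-cluster tilting module for the ring `R`: `M` is a finite module and,
among the finite (= finite-dimensional) `R`-modules `X`, the members of `add M` are exactly
those with `Ext^i(M, X) = 0` for `1 ≤ i ≤ n - 1`, and also exactly those with
`Ext^i(X, M) = 0` for `1 ≤ i ≤ n - 1`. -/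
def IsNClusterTilting (n : ℕ) (M : ModuleCat.{u} R) : Prop :=
  Module.Finite R M ∧
  (∀ X : ModuleCat.{u} R, Module.Finite R X →
    (MemAdd R M X ↔ ∀ i, 1 ≤ i → i ≤ n - 1 → ExtVanish R i M X)) ∧
  (∀ X : ModuleCat.{u} R, Module.Finite R X →
    (MemAdd R M X ↔ ∀ i, 1 ≤ i → i ≤ n - 1 → ExtVanish R i X M))

/-- `X` admits a projective resolution `0 → P_m → ⋯ → P_0 → X → 0` of length at most `m`. -/
def ProjDimLE (X : ModuleCat.{u} R) (m : ℕ) : Prop :=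
  ∃ (P : ℕ → ModuleCat.{u} R) (d : ∀ i, P (i + 1) ⟶ P i) (ε : P 0 ⟶ X),
    (∀ i, i ≤ m → Module.Projective R (P i)) ∧
    (∀ i, m < i → Subsingleton (P i)) ∧
    Function.Surjective ε ∧ Function.Exact (d 0) ε ∧
    (∀ i, Function.Exact (d (i + 1)) (d i))

/-- The projective dimension of the `R`-module `X`, as an extended natural number. -/
noncomputable def projDim (X : ModuleCat.{u} R) : ℕ∞ :=
  sInf {n : ℕ∞ | ∃ m : ℕ, n = (m : ℕ∞) ∧ ProjDimLE R X m}

/-- The global dimension of the ring `R`: the supremum of the projective dimensions of all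
finite (= finite-dimensional) `R`-modules. -/
noncomputable def globalDim : ℕ∞ :=
  ⨆ (X : ModuleCat.{u} R) (_ : Module.Finite R X), projDim R X

/-- There is an exact sequence `0 → R → I_0 → ⋯ → I_{m-1}` of `R`-modules in which every
`I_j` is both projective and injective. -/
def DomDimGE (m : ℕ) : Prop :=
  ∃ (I : ℕ → ModuleCat.{u} R) (f : ModuleCat.of R R ⟶ I 0) (d : ∀ i, I i ⟶ I (i + 1)),
    (∀ i, i < m → Module.Projective R (I i) ∧ Module.Injective R (I i)) ∧
    (1 ≤ m → Function.Injective f) ∧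
    (2 ≤ m → Function.Exact f (d 0)) ∧
    (∀ i, i + 3 ≤ m → Function.Exact (d i) (d (i + 1)))

/-- The dominant dimension of the ring `R`: the supremum of the lengths `m` of exact sequences
`0 → R → I_0 → ⋯ → I_{m-1}` with all `I_j` projective and injective. -/
noncomputable def domDim : ℕ∞ :=
  sSup {n : ℕ∞ | ∃ m : ℕ, n = (m : ℕ∞) ∧ DomDimGE R m}

end HomologicalDefs

theorem CategoryTheory.ShortComplex.ShortExact.exists_section_of_subsingleton_ext
    {C : Type*} [Category* C] [Abelian C] [EnoughProjectives C]
    {S : ShortComplex C} (hS : S.ShortExact)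
    (h : Subsingleton (((Ext ℤ C 1).obj (Opposite.op S.X₃)).obj S.X₁)) :
    ∃ s : S.X₃ ⟶ S.X₂, s ≫ S.g = 𝟙 S.X₃ := by
  have := hS.mono_f
  have := hS.epi_g
  let P := projectiveResolution S.X₃
  let p : P.complex.X 0 ⟶ S.X₃ := P.π.f 0
  have hdp : P.complex.d 1 0 ≫ p = 0 := P.complex_d_comp_π_f_zero
  let t : P.complex.X 0 ⟶ S.X₂ := Projective.factorThru p S.g
  have ht : t ≫ S.g = p := Projective.factorThru_comp _ _
  let c : P.complex.X 1 ⟶ S.X₁ :=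
    hS.exact.lift (P.complex.d 1 0 ≫ t) (by rw [Category.assoc, ht, hdp])
  have hc : c ≫ S.f = P.complex.d 1 0 ≫ t := hS.exact.lift_f _ _
  have hdc : P.complex.d 2 1 ≫ c = 0 := by
    rw [← cancel_mono S.f, Category.assoc, hc, HomologicalComplex.d_comp_d_assoc, Limits.zero_comp,
      Limits.zero_comp]
  have hex : (P.complex.linearYonedaObj ℤ S.X₁).ExactAt 1 := by
    rw [HomologicalComplex.exactAt_iff_isZero_homology]
    exact (ModuleCat.isZero_of_subsingleton _).of_iso (P.isoExt 1 S.X₁).symm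
  rw [HomologicalComplex.exactAt_iff' _ 0 1 2 (by simp) (by simp),
    ShortComplex.moduleCat_exact_iff] at hex
  obtain ⟨b, hb⟩ : ∃ b : P.complex.X 0 ⟶ S.X₁, P.complex.d 1 0 ≫ b = c := hex c hdc
  have hz : P.complex.d 1 0 ≫ (t - b ≫ S.f) = 0 := by
    rw [Preadditive.comp_sub, reassoc_of% hb, hc, sub_self]
  have : Epi p := inferInstanceAs (Epi (P.π.f 0))
  obtain ⟨s, hs⟩ : ∃ s : S.X₃ ⟶ S.X₂, p ≫ s = t - b ≫ S.f :=
    ⟨P.exact₀.desc _ hz, P.exact₀.g_desc _ _⟩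
  refine ⟨s, ?_⟩
  rw [← cancel_epi p]
  rw [reassoc_of% hs]
  simp [ht]

namespace Representation

/-- A nonzero representation of a finite `p`-group in characteristic `p` has a nonzero invariant. -/
theorem exists_mem_invariants_ne_zero {K G V : Type*} [Field K] [Group G] [Finite G]
    [AddCommGroup V] [Module K V] {p : ℕ} [Fact p.Prime] [CharP K p] (hG : IsPGroup p G)
    (ρ : Representation K G V) [Nontrivial V] : ∃ v ∈ ρ.invariants, v ≠ 0 := by
  obtain ⟨v, hv⟩ := exists_ne (0 : V)
  let : Module (ZMod p) V := Module.compHom V (ZMod.castHom dvd_rfl K)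
  let W : Submodule (ZMod p) V := Submodule.span _ (Set.range fun g ↦ ρ g v)
  have hmem (g : G) {w : V} (hw : w ∈ W) : ρ g w ∈ W := by
    induction hw using Submodule.span_induction with
    | mem x hx =>
      obtain ⟨h, rfl⟩ := hx
      exact Submodule.subset_span ⟨g * h, by simp⟩
    | zero => simp
    | add x y _ _ hx hy => simpa using W.add_mem hx hy
    | smul a x _ hx =>
      have : ρ g (a • x) = a • ρ g x := (ρ g).map_smul (ZMod.castHom dvd_rfl K a) x
      exact this ▸ W.smul_mem a hx
  let : MulAction G W :=
    { smul g w := ⟨ρ g w, hmem g w.2⟩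
      one_smul w := Subtype.ext (by change ρ 1 (w : V) = w; simp)
      mul_smul g h w := Subtype.ext (by change ρ (g * h) (w : V) = ρ g (ρ h w); simp) }
  have : Module.Finite (ZMod p) W := Module.Finite.span_of_finite _ (Set.finite_range _)
  have : Finite W := Module.finite_of_finite (ZMod p)
  have hvW : v ∈ W := Submodule.subset_span ⟨1, by simp⟩
  have : Nontrivial W := ⟨⟨v, hvW⟩, 0, fun h ↦ hv congr(($h : V))⟩
  have hcard : p ∣ Nat.card W := by
    rw [Module.natCard_eq_pow_finrank (K := ZMod p), Nat.card_zmod]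
    exact dvd_pow_self _ Module.finrank_pos.ne'
  obtain ⟨w, hw, hw0⟩ := hG.exists_fixed_point_of_prime_dvd_card_of_fixed_point W hcard
    (a := 0) fun g ↦ Subtype.ext (map_zero (ρ g))
  exact ⟨w, fun g ↦ congr(($(hw g) : V)), fun h ↦ hw0 (Subtype.ext h.symm)⟩

/-- If a representation of a `p`-group in characteristic `p` has vanishing first cohomology, then
each of its invariants is the trace of some vector. -/
theorem exists_norm_eq_of_cocycle_eq_coboundary {K G V : Type*} [Field K] [Group G] [Fintype G]
    [AddCommGroup V] [Module K V] {p : ℕ} [Fact p.Prime] [CharP K p] (hG : IsPGroup p G)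
    (ρ : Representation K G V)
    (hρ : ∀ c : G → V, (∀ g h, c (g * h) = ρ g (c h) + c g) → ∃ v, ∀ g, c g = ρ g v - v)
    {v : V} (hv : v ∈ ρ.invariants) : ∃ w, ρ.norm w = v := by
  classical
  obtain ⟨r, hr⟩ := ρ.invariants.subtype.exists_leftInverse_of_injective
    (LinearMap.ker_eq_bot.2 Subtype.val_injective)
  let σ : Representation K G (G → ρ.invariants) :=
    { toFun g := LinearMap.funLeft K _ (· * g)
      map_one' := by ext; simp [LinearMap.funLeft]
      map_mul' g h := by ext; simp [LinearMap.funLeft, mul_assoc] }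
  have hσ (g h : G) (f : G → ρ.invariants) : σ g f h = f (h * g) := rfl
  let φ : V →ₗ[K] (G → ρ.invariants) := LinearMap.pi fun g ↦ r ∘ₗ ρ g
  have hφ (g : G) (x : V) : φ x g = r (ρ g x) := rfl
  have hequiv (g : G) (x : V) : φ (ρ g x) = σ g (φ x) := by
    ext h; simp [hφ, hσ]
  have hconst {x : V} (hx : x ∈ ρ.invariants) (g : G) : φ x g = ⟨x, hx⟩ := by
    rw [hφ, hx g]
    exact congr($hr ⟨x, hx⟩)
  have hinj : Function.Injective φ := by
    rw [← LinearMap.ker_eq_bot, ← not_ne_iff, ← Submodule.nontrivial_iff_ne_bot]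
    intro
    obtain ⟨x, hx, hx0⟩ := exists_mem_invariants_ne_zero hG (ρ.subrepresentation (LinearMap.ker φ)
      fun g x hx ↦ by simp_all)
    have hx' : (x : V) ∈ ρ.invariants := fun g ↦ congr(($(hx g) : V))
    have h0 := hconst hx' 1
    rw [LinearMap.mem_ker.1 x.2] at h0
    exact hx0 (Subtype.ext congr(($h0.symm : V)))
  have hsurj : Function.Surjective φ := by
    rw [← LinearMap.range_eq_top, ← not_ne_iff, ← Submodule.Quotient.nontrivial_iff]
    intro
    have hle (g : G) : LinearMap.range φ ≤ (LinearMap.range φ).comap (σ g) := by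
      rintro _ ⟨x, rfl⟩
      exact ⟨ρ g x, hequiv g x⟩
    obtain ⟨y, hy, hy0⟩ := exists_mem_invariants_ne_zero hG (σ.quotient _ hle)
    obtain ⟨f, rfl⟩ := Submodule.Quotient.mk_surjective _ y
    have hf (g : G) : ∃ x, φ x = σ g f - f := (Submodule.Quotient.eq _).1 (hy g)
    choose c hc using hf
    obtain ⟨x, hx⟩ := hρ c fun g h ↦ hinj (by simp [hequiv, hc])
    have hfx (g : G) : σ g (f - φ x) = f - φ x := by
      have := hc g
      rw [hx, map_sub, hequiv] at this
      rw [map_sub, sub_eq_sub_iff_sub_eq_sub, this]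
    have hmem : f - φ x ∈ LinearMap.range φ := by
      refine ⟨(f - φ x) 1, funext fun g ↦ ?_⟩
      rw [hconst (Subtype.prop _)]
      have := congrFun (hfx g) 1
      rw [hσ, one_mul] at this
      exact this.symm
    refine hy0 ((Submodule.Quotient.mk_eq_zero _).2 ?_)
    simpa using add_mem hmem (LinearMap.mem_range_self φ x)
  obtain ⟨w, hw⟩ := hsurj (Pi.single 1 ⟨v, hv⟩)
  refine ⟨w, hinj (funext fun g ↦ ?_)⟩
  rw [hconst hv, norm, LinearMap.sum_apply, map_sum, Finset.sum_apply,
    Finset.sum_eq_single g⁻¹]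
  · simp [hequiv, hσ, hw]
  · intro h _ hh
    rw [hequiv, hσ, hw, Pi.single_eq_of_ne]
    exact fun h1 ↦ hh (eq_inv_of_mul_eq_one_right h1)
  · simp

end Representation

section TransportedGroupAlgebra

variable {K G R : Type*} [Field K] [Group G] [Ring R] [Algebra K R]

/-- The representation of `G` on an `R`-module given by identifying `R` with `K[G]`. -/
noncomputable def Representation.ofAlgEquiv (e : MonoidAlgebra K G ≃ₐ[K] R) (M : Type*)
    [AddCommGroup M] [Module K M] [Module R M] [IsScalarTower K R M] : Representation K G M :=
  ((Algebra.lsmul K K M).comp e.toAlgHom : MonoidAlgebra K G →* Module.End K M).comp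
    (MonoidAlgebra.of K G)

theorem Representation.ofAlgEquiv_apply (e : MonoidAlgebra K G ≃ₐ[K] R) {M : Type*}
    [AddCommGroup M] [Module K M] [Module R M] [IsScalarTower K R M] (g : G) (m : M) :
    ofAlgEquiv e M g m = e (MonoidAlgebra.of K G g) • m := rfl

theorem LinearMap.map_smul_of_comp_ofAlgEquiv_eq {e : MonoidAlgebra K G ≃ₐ[K] R} {M N : Type*}
    [AddCommGroup M] [Module K M] [Module R M] [IsScalarTower K R M]
    [AddCommGroup N] [Module K N] [Module R N] [IsScalarTower K R N] (f : M →ₗ[K] N)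
    (hf : ∀ g m, f (Representation.ofAlgEquiv e M g m) = Representation.ofAlgEquiv e N g (f m))
    (r : R) (m : M) : f (r • m) = r • f m := by
  obtain ⟨a, rfl⟩ := e.surjective r
  induction a using MonoidAlgebra.induction_on with
  | of g => exact hf g m
  | add a b ha hb => simp only [map_add, add_smul, ha, hb]
  | smul k a ha => simp only [map_smul, smul_assoc, ha]

/-- Higman's criterion: a module over a group algebra is projective as soon as its identity is
the trace of a linear endomorphism. -/
theorem Module.Projective.of_norm_linHom_eq_id [Fintype G] {e : MonoidAlgebra K G ≃ₐ[K] R}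
    {M : Type*} [AddCommGroup M] [Module K M] [Module R M] [IsScalarTower K R M] (θ : M →ₗ[K] M)
    (hθ : (Representation.linHom (Representation.ofAlgEquiv e M)
      (Representation.ofAlgEquiv e M)).norm θ = LinearMap.id) : Module.Projective R M := by
  let π : (M →₀ R) →ₗ[R] M := Finsupp.linearCombination R id
  obtain ⟨s, hs⟩ := (π.restrictScalars K).exists_rightInverse_of_surjective
    (LinearMap.range_eq_top.2 (Finsupp.linearCombination_id_surjective R M))
  let τ := Representation.linHom (Representation.ofAlgEquiv e M)
    (Representation.ofAlgEquiv e (M →₀ R))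
  let t : M →ₗ[K] (M →₀ R) := τ.norm (s ∘ₗ θ)
  have ht (g : G) (m : M) : t (Representation.ofAlgEquiv e M g m) =
      Representation.ofAlgEquiv e (M →₀ R) g (t m) := by
    have := LinearMap.congr_fun (τ.self_norm_apply g (s ∘ₗ θ)) (Representation.ofAlgEquiv e M g m)
    rw [Representation.linHom_apply] at this
    simpa [t] using this.symm
  refine ⟨⟨{ t with map_smul' := t.map_smul_of_comp_ofAlgEquiv_eq ht }, fun m ↦ ?_⟩⟩
  have hm := congr($hθ m)
  rw [LinearMap.id_apply] at hm
  conv_rhs => rw [← hm]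
  change π (t m) = _
  simp only [t, τ, Representation.norm, LinearMap.sum_apply, map_sum, Representation.linHom_apply,
    LinearMap.comp_apply]
  refine Finset.sum_congr rfl fun g _ ↦ ?_
  rw [Representation.ofAlgEquiv_apply, map_smul, Representation.ofAlgEquiv_apply e g]
  exact congr(e (MonoidAlgebra.of K G g) • $hs _)

/-- If all extensions of `M` by itself split, then every cocycle with values in `End_K M` is a
coboundary. -/
theorem Representation.exists_eq_coboundary_of_forall_split {R M : Type u} [Ring R] [Algebra K R]
    (e : MonoidAlgebra K G ≃ₐ[K] R) [AddCommGroup M] [Module K M] [Module R M]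
    [IsScalarTower K R M]
    (hM : ∀ (E : Type u) [AddCommGroup E] [Module R E] (i : M →ₗ[R] E) (q : E →ₗ[R] M),
      Function.Injective i → Function.Surjective q → Function.Exact i q →
        ∃ s : M →ₗ[R] E, q ∘ₗ s = LinearMap.id)
    (c : G → M →ₗ[K] M)
    (hc : ∀ g h, c (g * h) = linHom (ofAlgEquiv e M) (ofAlgEquiv e M) g (c h) + c g) :
    ∃ f, ∀ g, c g = linHom (ofAlgEquiv e M) (ofAlgEquiv e M) g f - f := by
  set ρ := ofAlgEquiv e M
  have hinv (g : G) (m : M) : ρ g⁻¹ (ρ g m) = m := ρ.inv_self_apply g m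
  have hc1 : c 1 = 0 := by simpa using hc 1 1
  let ρE : Representation K G (M × M) :=
    { toFun g := LinearMap.prod (ρ g ∘ₗ LinearMap.fst K M M + c g ∘ₗ ρ g ∘ₗ LinearMap.snd K M M)
        (ρ g ∘ₗ LinearMap.snd K M M)
      map_one' := by ext <;> simp [hc1]
      map_mul' g h := by
        ext m <;> simp [hc, linHom_apply, hinv] }
  let : Module R ρE.asModule :=
    Module.compHom (M × M) (ρE.asAlgebraHom.comp (e.symm : R →ₐ[K] MonoidAlgebra K G)).toRingHom
  have hsmul (r : R) (x : ρE.asModule) : r • x = (ρE.asAlgebraHom (e.symm r) x : M × M) := rfl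
  have : IsScalarTower K R ρE.asModule := .of_algebraMap_smul fun k x ↦ by
    rw [hsmul, AlgEquiv.commutes, AlgHom.commutes]
    rfl
  have hE (g : G) (x : ρE.asModule) : ofAlgEquiv e ρE.asModule g x = (ρE g x : M × M) := by
    rw [ofAlgEquiv_apply, hsmul, e.symm_apply_apply, MonoidAlgebra.of_apply, asAlgebraHom_single,
      one_smul]
  let i : M →ₗ[K] ρE.asModule := LinearMap.inl K M M
  let q : ρE.asModule →ₗ[K] M := LinearMap.snd K M M
  have hi (g : G) (m : M) : i (ρ g m) = ofAlgEquiv e ρE.asModule g (i m) := by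
    refine Eq.trans ?_ (hE g (m, 0)).symm
    change (_, _) = (_, _)
    simp
  have hq (g : G) (x : ρE.asModule) : q (ofAlgEquiv e ρE.asModule g x) = ρ g (q x) :=
    congr_arg Prod.snd (hE g x)
  obtain ⟨s, hs⟩ := hM ρE.asModule
    { i with map_smul' := i.map_smul_of_comp_ofAlgEquiv_eq hi }
    { q with map_smul' := q.map_smul_of_comp_ofAlgEquiv_eq hq }
    (LinearMap.inl_injective (R := K)) (LinearMap.snd_surjective (R := K))
    (Function.Exact.inl_snd (R := K))
  let u : M →ₗ[K] M := LinearMap.fst K M M ∘ₗ (s.restrictScalars K : M →ₗ[K] ρE.asModule)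
  have hu (m : M) : s m = ((u m, m) : M × M) := Prod.ext rfl congr($hs m)
  refine ⟨-u, fun g ↦ LinearMap.ext fun m ↦ ?_⟩
  have key : u (ρ g (ρ g⁻¹ m)) = ρ g (u (ρ g⁻¹ m)) + c g (ρ g (ρ g⁻¹ m)) := by
    have h1 : s (ρ g (ρ g⁻¹ m)) = (ρE g (s (ρ g⁻¹ m)) : M × M) :=
      (s.map_smul _ _).trans (hE g _)
    rw [hu] at h1
    refine (congr_arg Prod.fst h1).trans ?_
    rw [hu]
    rfl
  rw [ρ.self_inv_apply] at key
  simp [linHom_apply, key]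

end TransportedGroupAlgebra

theorem exists_section_of_extVanish {R : Type u} [Ring R] {M N : ModuleCat.{u} R}
    (h : ExtVanish R 1 M N) {E : Type u} [AddCommGroup E] [Module R E] (i : N →ₗ[R] E)
    (q : E →ₗ[R] M) (hi : Function.Injective i) (hq : Function.Surjective q)
    (hiq : Function.Exact i q) : ∃ s : M →ₗ[R] E, q ∘ₗ s = LinearMap.id := by
  let S : ShortComplex (ModuleCat.{u} R) := ShortComplex.mk (ModuleCat.ofHom i)
    (ModuleCat.ofHom q) (by ext x; exact hiq.apply_apply_eq_zero x)
  have hS : S.ShortExact :=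
    { exact := (ShortComplex.ShortExact.moduleCat_exact_iff_function_exact S).2 hiq
      mono_f := (ModuleCat.mono_iff_injective _).2 hi
      epi_g := (ModuleCat.epi_iff_surjective _).2 hq }
  obtain ⟨s, hs⟩ := hS.exists_section_of_subsingleton_ext h
  exact ⟨s.hom, congr(($hs).hom)⟩

/-- The inversion of `G` identifies its group algebra with the opposite algebra. -/
noncomputable def MonoidAlgebra.invOpAlgEquiv (K G : Type*) [CommSemiring K] [Group G] :
    MonoidAlgebra K G ≃ₐ[K] (MonoidAlgebra K G)ᵐᵒᵖ :=
  let f : MonoidAlgebra K G →ₐ[K] (MonoidAlgebra K G)ᵐᵒᵖ := MonoidAlgebra.lift K _ G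
    { toFun g := .op (MonoidAlgebra.of K G g⁻¹)
      map_one' := by simp [MonoidAlgebra.one_def]
      map_mul' g h := by rw [mul_inv_rev, map_mul, MulOpposite.op_mul] }
  AlgEquiv.ofAlgHom f ((AlgEquiv.opOp K (MonoidAlgebra K G)).symm.toAlgHom.comp (AlgHom.op f))
    (by
      ext x
      induction x using MulOpposite.rec' with | _ a
      induction a using MonoidAlgebra.induction_on with
      | of g => simp [f]
      | add a b ha hb => simp only [MulOpposite.op_add, map_add, ha, hb]
      | smul k a ha => simp only [MulOpposite.op_smul, map_smul, ha])
    (by ext; simp [f])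

/-- Over a `p`-group in characteristic `p`, a module without self-extensions is projective. -/
theorem projective_of_extVanish_self {K : Type u} {G : Type*} [Field K] [Group G] [Finite G]
    {p : ℕ} [Fact p.Prime] [CharP K p] (hG : IsPGroup p G) {R : Type u} [Ring R] [Algebra K R]
    (e : MonoidAlgebra K G ≃ₐ[K] R) (M : ModuleCat.{u} R) (h : ExtVanish R 1 M M) :
    Module.Projective R M := by
  have := Fintype.ofFinite G
  let : Module K M := Module.compHom M (algebraMap K R)
  have : IsScalarTower K R M := IsScalarTower.of_algebraMap_smul fun _ _ ↦ rfl
  obtain ⟨θ, hθ⟩ := Representation.exists_norm_eq_of_cocycle_eq_coboundary hG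
    (Representation.linHom (Representation.ofAlgEquiv e M)
      (Representation.ofAlgEquiv e M))
    (Representation.exists_eq_coboundary_of_forall_split e fun E _ _ i q ↦
      exists_section_of_extVanish h i q) (v := LinearMap.id)
    (fun g ↦ LinearMap.ext fun m ↦ by simp [Representation.linHom_apply])
  exact Module.Projective.of_norm_linHom_eq_id θ hθ

/-- **Tachikawa.** Let `K` be a field of characteristic two and let `G` be the
quaternion group of order `8`.  Then `Ext¹_{KG}(M, M) ≠ 0` for every non-projective
finite-dimensional right `KG`-module `M`. -/
theorem ext_one_self_ne_zero_of_not_projective (K : Type u) [Field K] [CharP K 2]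
    (M : ModuleCat.{u} (MonoidAlgebra K (QuaternionGroup 2))ᵐᵒᵖ)
    (hfin : Module.Finite (MonoidAlgebra K (QuaternionGroup 2))ᵐᵒᵖ M)
    (hnproj : ¬ Module.Projective (MonoidAlgebra K (QuaternionGroup 2))ᵐᵒᵖ M) :
    ¬ ExtVanish (MonoidAlgebra K (QuaternionGroup 2))ᵐᵒᵖ 1 M M := by
  have hG : IsPGroup 2 (QuaternionGroup 2) :=
    IsPGroup.of_card (n := 3) (by rw [Nat.card_eq_fintype_card, QuaternionGroup.card]; rfl)
  exact fun h ↦ hnproj (projective_of_extVanish_self hG (MonoidAlgebra.invOpAlgEquiv K _) M h)
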